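/- Let H0 be a hierarchy on [n] and T0 its induced triplet set. Then Trev(H0, T0) = 3·Σ_{N} |N1|·|N2|·|N|² − (2n+2)·(n³−n)/3, where the sum ranges over the internal nodes N of H0, N1 and N2 denote the two children of N, and |N| denotes the number of leaves in the subtree rooted at N. -/

import Mathlib

open Finset MeasureTheory

namespace CompHC

/-- A rooted binary tree with leaves labelled by elements of `Fin n`. -/
inductive HTree (n : ℕ) : Type
  | leaf (i : Fin n) : HTree n
  | node (l r : HTree n) : HTree n

namespace HTree

/-- The list of leaf labels of a tree. -/
def leaves {n : ℕ} : HTree n → List (Fin n)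
  | .leaf i => [i]
  | .node l r => l.leaves ++ r.leaves

/-- The number of leaves of a tree. -/
def size {n : ℕ} (t : HTree n) : ℕ := t.leaves.length

/-- `|H(i ∨ j)|`: the number of leaves of the smallest subtree containing both `i` and `j`. -/
def lcaSize {n : ℕ} : HTree n → Fin n → Fin n → ℕ
  | .leaf _, _, _ => 1
  | .node l r, i, j =>
      if i ∈ l.leaves ∧ j ∈ l.leaves then l.lcaSize i j
      else if i ∈ r.leaves ∧ j ∈ r.leaves then r.lcaSize i j
      else l.size + r.size

/-- Sum of `f |N1| |N2|` over the internal nodes `N` of the tree, `N1, N2` its children. -/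
def internalSum {n : ℕ} (f : ℕ → ℕ → ℕ) : HTree n → ℕ
  | .leaf _ => 0
  | .node l r => f l.size r.size + l.internalSum f + r.internalSum f

end HTree

/-- A hierarchy on `[n]`: every object appears exactly once as a leaf. -/
def IsHierarchy {n : ℕ} (t : HTree n) : Prop :=
  t.leaves.Nodup ∧ ∀ i : Fin n, i ∈ t.leaves

abbrev Triplet (n : ℕ) := Fin n × Fin n × Fin n
abbrev Quadruplet (n : ℕ) := Fin n × Fin n × Fin n × Fin n

/-- The entries of a triplet are pairwise distinct. -/
def distinctTriplet {n : ℕ} (t : Triplet n) : Prop :=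
  t.1 ≠ t.2.1 ∧ t.1 ≠ t.2.2 ∧ t.2.1 ≠ t.2.2

/-- A quadruplet `(i,j,k,l)` satisfies `i<j`, `k<l`, `(i,j) ≠ (k,l)`. -/
def validQuadruplet {n : ℕ} (q : Quadruplet n) : Prop :=
  q.1 < q.2.1 ∧ q.2.2.1 < q.2.2.2 ∧ (q.1, q.2.1) ≠ (q.2.2.1, q.2.2.2)

/-- Triplet revenue `Trev(H,T) = Σ_{(i,j,k)∈T} (|H(i∨k)| − |H(i∨j)|)`. -/
def Trev {n : ℕ} (H : HTree n) (T : Finset (Triplet n)) : ℤ :=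
  ∑ t ∈ T, ((H.lcaSize t.1 t.2.2 : ℤ) - (H.lcaSize t.1 t.2.1 : ℤ))

/-- Quadruplet revenue `Qrev(H,Q) = Σ_{(i,j,k,l)∈Q} (|H(k∨l)| − |H(i∨j)|)`. -/
def Qrev {n : ℕ} (H : HTree n) (Q : Finset (Quadruplet n)) : ℤ :=
  ∑ q ∈ Q, ((H.lcaSize q.2.2.1 q.2.2.2 : ℤ) - (H.lcaSize q.1 q.2.1 : ℤ))

/-- The set of pairs `(i,j)` with `i < j`. -/
def pairs (n : ℕ) : Finset (Fin n × Fin n) :=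
  Finset.univ.filter fun p => p.1 < p.2

/-- Dasgupta's cost `Dcost(H,s) = Σ_{i<j} s_{ij}·|H(i∨j)|`. -/
noncomputable def Dcost {n : ℕ} (H : HTree n) (s : Fin n → Fin n → ℝ) : ℝ :=
  ∑ p ∈ pairs n, s p.1 p.2 * (H.lcaSize p.1 p.2 : ℝ)

/-- The AddS3 similarity computed from a triplet set. -/
def sAddS3 {n : ℕ} (T : Finset (Triplet n)) (i j : Fin n) : ℤ :=
  ∑ k ∈ Finset.univ.filter (fun k : Fin n => k ≠ i ∧ k ≠ j),
    (((if (i, j, k) ∈ T then 1 else 0) - (if (i, k, j) ∈ T then 1 else 0)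
      + (if (j, i, k) ∈ T then 1 else 0) - (if (j, k, i) ∈ T then 1 else 0) : ℤ))

/-- The AddS4 similarity computed from a quadruplet set. -/
def sAddS4 {n : ℕ} (Q : Finset (Quadruplet n)) (i j : Fin n) : ℤ :=
  ∑ p ∈ (pairs n).filter (fun p => p ≠ (i, j)),
    (((if (i, j, p.1, p.2) ∈ Q then 1 else 0)
      - (if (p.1, p.2, i, j) ∈ Q then 1 else 0) : ℤ))

/-- The triplet set induced by a hierarchy `H0`:
`T0 = {(i,j,k) : i,j,k pairwise distinct, |H0(i∨j)| < min(|H0(i∨k)|, |H0(j∨k)|)}`. -/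
def inducedTriplets {n : ℕ} (H : HTree n) : Finset (Triplet n) :=
  Finset.univ.filter fun t : Triplet n =>
    t.1 ≠ t.2.1 ∧ t.1 ≠ t.2.2 ∧ t.2.1 ≠ t.2.2 ∧
    H.lcaSize t.1 t.2.1 < min (H.lcaSize t.1 t.2.2) (H.lcaSize t.2.1 t.2.2)


namespace HTree

variable {n : ℕ}

lemma size_node (l r : HTree n) : (node l r).size = l.size + r.size := by
  simp [size, leaves]

lemma size_pos (t : HTree n) : 0 < t.size := by
  induction t with
  | leaf i => simp [size, leaves]
  | node l r hl hr => rw [size_node]; omega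

lemma lcaSize_pos (t : HTree n) (i j : Fin n) : 0 < t.lcaSize i j := by
  induction t with
  | leaf i => simp [lcaSize]
  | node l r hl hr =>
    have := l.size_pos
    simp only [lcaSize]
    split_ifs <;> omega

lemma lcaSize_le_size (t : HTree n) (i j : Fin n) : t.lcaSize i j ≤ t.size := by
  induction t with
  | leaf i => simp [lcaSize, size, leaves]
  | node l r hl hr =>
    simp only [lcaSize, size_node]
    split_ifs <;> omega

lemma lcaSize_self (t : HTree n) {i : Fin n} (hi : i ∈ t.leaves) : t.lcaSize i i = 1 := by
  induction t with
  | leaf i => simp [lcaSize]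
  | node l r hl hr =>
    simp only [leaves, List.mem_append] at hi
    simp only [lcaSize, and_self]
    split_ifs with h₁ h₂
    · exact hl h₁
    · exact hr h₂
    · tauto

section Node

variable {l r : HTree n} {i j : Fin n}

lemma lcaSize_node_of_mem_left (hi : i ∈ l.leaves) (hj : j ∈ l.leaves) :
    (node l r).lcaSize i j = l.lcaSize i j := by
  simp [lcaSize, hi, hj]

lemma lcaSize_node_of_mem_right (h : l.leaves.Disjoint r.leaves)
    (hi : i ∈ r.leaves) (hj : j ∈ r.leaves) :
    (node l r).lcaSize i j = r.lcaSize i j := by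
  have hi' : i ∉ l.leaves := fun h' => h h' hi
  simp [lcaSize, hi, hj, hi']

lemma lcaSize_node_of_mem_left_right (h : l.leaves.Disjoint r.leaves)
    (hi : i ∈ l.leaves) (hj : j ∈ r.leaves) :
    (node l r).lcaSize i j = l.size + r.size := by
  have hi' : i ∉ r.leaves := fun h' => h hi h'
  have hj' : j ∉ l.leaves := fun h' => h h' hj
  simp [lcaSize, hi', hj']

lemma lcaSize_node_of_mem_right_left (h : l.leaves.Disjoint r.leaves)
    (hi : i ∈ r.leaves) (hj : j ∈ l.leaves) :
    (node l r).lcaSize i j = l.size + r.size := by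
  have hi' : i ∉ l.leaves := fun h' => h h' hi
  have hj' : j ∉ r.leaves := fun h' => h hj h'
  simp [lcaSize, hi', hj']

end Node

lemma card_toFinset_leaves {t : HTree n} (h : t.leaves.Nodup) :
    t.leaves.toFinset.card = t.size := List.toFinset_card_of_nodup h

/-- A sum over the leaves of a node splits over its two children. -/
lemma sum_leaves_node {l r : HTree n} (h : l.leaves.Disjoint r.leaves) (f : Fin n → ℤ) :
    ∑ i ∈ (node l r).leaves.toFinset, f i =
      ∑ i ∈ l.leaves.toFinset, f i + ∑ i ∈ r.leaves.toFinset, f i := by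
  rw [leaves, List.toFinset_append, Finset.sum_union]
  exact List.disjoint_toFinset_iff_disjoint.2 h

/-- The total size of the least common ancestors does not depend on the shape of the tree. -/
lemma sum_lcaSize (t : HTree n) (ht : t.leaves.Nodup) :
    3 * ∑ i ∈ t.leaves.toFinset, ∑ j ∈ t.leaves.toFinset, (t.lcaSize i j : ℤ) =
      2 * (t.size : ℤ) ^ 3 + t.size := by
  induction t with
  | leaf i => simp [lcaSize, size, leaves]
  | node l r hl hr =>
    obtain ⟨hln, hrn, hd⟩ := List.nodup_append'.1 ht
    have hll : ∑ i ∈ l.leaves.toFinset, ∑ j ∈ l.leaves.toFinset,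
        ((node l r).lcaSize i j : ℤ) =
        ∑ i ∈ l.leaves.toFinset, ∑ j ∈ l.leaves.toFinset, (l.lcaSize i j : ℤ) := by
      refine Finset.sum_congr rfl fun i hi => Finset.sum_congr rfl fun j hj => ?_
      rw [lcaSize_node_of_mem_left (List.mem_toFinset.1 hi) (List.mem_toFinset.1 hj)]
    have hrr : ∑ i ∈ r.leaves.toFinset, ∑ j ∈ r.leaves.toFinset,
        ((node l r).lcaSize i j : ℤ) =
        ∑ i ∈ r.leaves.toFinset, ∑ j ∈ r.leaves.toFinset, (r.lcaSize i j : ℤ) := by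
      refine Finset.sum_congr rfl fun i hi => Finset.sum_congr rfl fun j hj => ?_
      rw [lcaSize_node_of_mem_right hd (List.mem_toFinset.1 hi) (List.mem_toFinset.1 hj)]
    have hlr : ∑ i ∈ l.leaves.toFinset, ∑ j ∈ r.leaves.toFinset,
        ((node l r).lcaSize i j : ℤ) = l.size * r.size * (l.size + r.size) := by
      rw [Finset.sum_congr rfl fun i hi => Finset.sum_congr rfl fun j hj => by
        rw [lcaSize_node_of_mem_left_right hd (List.mem_toFinset.1 hi) (List.mem_toFinset.1 hj)]]
      simp [card_toFinset_leaves hln, card_toFinset_leaves hrn, mul_assoc]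
    have hrl : ∑ i ∈ r.leaves.toFinset, ∑ j ∈ l.leaves.toFinset,
        ((node l r).lcaSize i j : ℤ) = l.size * r.size * (l.size + r.size) := by
      rw [Finset.sum_congr rfl fun i hi => Finset.sum_congr rfl fun j hj => by
        rw [lcaSize_node_of_mem_right_left hd (List.mem_toFinset.1 hi) (List.mem_toFinset.1 hj)]]
      simp [card_toFinset_leaves hln, card_toFinset_leaves hrn]
      ring
    simp only [sum_leaves_node hd, Finset.sum_add_distrib]
    rw [hll, hlr, hrl, hrr, size_node]
    push_cast
    linear_combination hl hln + hr hrn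

/-- The revenue of a triplet in a tree, zero if the tree does not separate `k` from `i, j`. -/
def gain (t : HTree n) (i j k : Fin n) : ℤ :=
  if t.lcaSize i j < min (t.lcaSize i k) (t.lcaSize j k) then
    (t.lcaSize i k : ℤ) - t.lcaSize i j
  else 0

section Gain

variable {l r : HTree n} {i j k : Fin n}

lemma gain_node_of_mem_left (hi : i ∈ l.leaves) (hj : j ∈ l.leaves) (hk : k ∈ l.leaves) :
    (node l r).gain i j k = l.gain i j k := by
  simp only [gain, lcaSize_node_of_mem_left, hi, hj, hk]

lemma gain_node_of_mem_right (h : l.leaves.Disjoint r.leaves)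
    (hi : i ∈ r.leaves) (hj : j ∈ r.leaves) (hk : k ∈ r.leaves) :
    (node l r).gain i j k = r.gain i j k := by
  simp only [gain, lcaSize_node_of_mem_right h, hi, hj, hk]

lemma gain_node_of_mem_left_left_right (h : l.leaves.Disjoint r.leaves)
    (hi : i ∈ l.leaves) (hj : j ∈ l.leaves) (hk : k ∈ r.leaves) :
    (node l r).gain i j k = (l.size + r.size : ℤ) - l.lcaSize i j := by
  have h₁ := l.lcaSize_le_size i j
  have h₂ := r.size_pos
  rw [gain, lcaSize_node_of_mem_left hi hj, lcaSize_node_of_mem_left_right h hi hk,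
    lcaSize_node_of_mem_left_right h hj hk, if_pos (by omega)]
  push_cast
  rfl

lemma gain_node_of_mem_right_right_left (h : l.leaves.Disjoint r.leaves)
    (hi : i ∈ r.leaves) (hj : j ∈ r.leaves) (hk : k ∈ l.leaves) :
    (node l r).gain i j k = (l.size + r.size : ℤ) - r.lcaSize i j := by
  have h₁ := r.lcaSize_le_size i j
  have h₂ := l.size_pos
  rw [gain, lcaSize_node_of_mem_right h hi hj, lcaSize_node_of_mem_right_left h hi hk,
    lcaSize_node_of_mem_right_left h hj hk, if_pos (by omega)]
  push_cast
  rfl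

lemma gain_eq_zero_of_size_le {t : HTree n} (h : t.size ≤ t.lcaSize i j) :
    t.gain i j k = 0 := by
  have := t.lcaSize_le_size i k
  rw [gain, if_neg (by omega)]

lemma gain_node_of_mem_left_right (h : l.leaves.Disjoint r.leaves)
    (hi : i ∈ l.leaves) (hj : j ∈ r.leaves) : (node l r).gain i j k = 0 :=
  gain_eq_zero_of_size_le (by rw [lcaSize_node_of_mem_left_right h hi hj, size_node])

lemma gain_node_of_mem_right_left (h : l.leaves.Disjoint r.leaves)
    (hi : i ∈ r.leaves) (hj : j ∈ l.leaves) : (node l r).gain i j k = 0 :=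
  gain_eq_zero_of_size_le (by rw [lcaSize_node_of_mem_right_left h hi hj, size_node])

end Gain

lemma sum_gain_node {l r : HTree n} (ht : (node l r).leaves.Nodup) :
    ∑ i ∈ (node l r).leaves.toFinset, ∑ j ∈ (node l r).leaves.toFinset,
      ∑ k ∈ (node l r).leaves.toFinset, (node l r).gain i j k =
    ∑ i ∈ l.leaves.toFinset, ∑ j ∈ l.leaves.toFinset, ∑ k ∈ l.leaves.toFinset, l.gain i j k +
    ∑ i ∈ r.leaves.toFinset, ∑ j ∈ r.leaves.toFinset, ∑ k ∈ r.leaves.toFinset, r.gain i j k +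
    r.size * ((l.size : ℤ) ^ 2 * (l.size + r.size) -
      ∑ i ∈ l.leaves.toFinset, ∑ j ∈ l.leaves.toFinset, (l.lcaSize i j : ℤ)) +
    l.size * ((r.size : ℤ) ^ 2 * (l.size + r.size) -
      ∑ i ∈ r.leaves.toFinset, ∑ j ∈ r.leaves.toFinset, (r.lcaSize i j : ℤ)) := by
  obtain ⟨hln, hrn, hd⟩ := List.nodup_append'.1 ht
  have hl : ∀ i ∈ l.leaves.toFinset,
      ∑ j ∈ (node l r).leaves.toFinset, ∑ k ∈ (node l r).leaves.toFinset,
        (node l r).gain i j k =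
      ∑ j ∈ l.leaves.toFinset, (∑ k ∈ l.leaves.toFinset, l.gain i j k +
        r.size * ((l.size + r.size : ℤ) - l.lcaSize i j)) := by
    intro i hi
    rw [List.mem_toFinset] at hi
    rw [sum_leaves_node hd, Finset.sum_eq_zero (s := r.leaves.toFinset), add_zero]
    · refine Finset.sum_congr rfl fun j hj => ?_
      rw [List.mem_toFinset] at hj
      rw [sum_leaves_node hd]
      congr 1
      · exact Finset.sum_congr rfl fun k hk =>
          gain_node_of_mem_left hi hj (List.mem_toFinset.1 hk)
      · rw [Finset.sum_congr rfl fun k hk =>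
          gain_node_of_mem_left_left_right hd hi hj (List.mem_toFinset.1 hk)]
        simp [card_toFinset_leaves hrn, mul_sub]
    · exact fun j hj => Finset.sum_eq_zero fun k _ =>
        gain_node_of_mem_left_right hd hi (List.mem_toFinset.1 hj)
  have hr : ∀ i ∈ r.leaves.toFinset,
      ∑ j ∈ (node l r).leaves.toFinset, ∑ k ∈ (node l r).leaves.toFinset,
        (node l r).gain i j k =
      ∑ j ∈ r.leaves.toFinset, (∑ k ∈ r.leaves.toFinset, r.gain i j k +
        l.size * ((l.size + r.size : ℤ) - r.lcaSize i j)) := by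
    intro i hi
    rw [List.mem_toFinset] at hi
    rw [sum_leaves_node hd, Finset.sum_eq_zero (s := l.leaves.toFinset), zero_add]
    · refine Finset.sum_congr rfl fun j hj => ?_
      rw [List.mem_toFinset] at hj
      rw [sum_leaves_node hd, add_comm]
      congr 1
      · exact Finset.sum_congr rfl fun k hk =>
          gain_node_of_mem_right hd hi hj (List.mem_toFinset.1 hk)
      · rw [Finset.sum_congr rfl fun k hk =>
          gain_node_of_mem_right_right_left hd hi hj (List.mem_toFinset.1 hk)]
        simp [card_toFinset_leaves hln, mul_sub]
    · exact fun j hj => Finset.sum_eq_zero fun k _ =>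
        gain_node_of_mem_right_left hd hi (List.mem_toFinset.1 hj)
  rw [sum_leaves_node hd, Finset.sum_congr rfl hl, Finset.sum_congr rfl hr]
  simp only [Finset.sum_add_distrib, ← Finset.mul_sum, Finset.sum_sub_distrib,
    Finset.sum_const, card_toFinset_leaves hln, card_toFinset_leaves hrn, nsmul_eq_mul]
  ring

lemma sum_gain (t : HTree n) (ht : t.leaves.Nodup) :
    3 * ∑ i ∈ t.leaves.toFinset, ∑ j ∈ t.leaves.toFinset, ∑ k ∈ t.leaves.toFinset,
        t.gain i j k =
      9 * (t.internalSum (fun a b => a * b * (a + b) ^ 2) : ℤ)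
        - (2 * (t.size : ℤ) + 2) * ((t.size : ℤ) ^ 3 - t.size)
        + (2 * (t.size : ℤ) ^ 3 + t.size) - 3 * (t.size : ℤ) ^ 2 := by
  induction t with
  | leaf i => simp [gain, lcaSize, size, leaves, internalSum]
  | node l r hl hr =>
    obtain ⟨hln, hrn, -⟩ := List.nodup_append'.1 ht
    rw [sum_gain_node ht, size_node, internalSum]
    push_cast
    linear_combination hl hln + hr hrn - r.size * l.sum_lcaSize hln
      - l.size * r.sum_lcaSize hrn

end HTree

/-- Discarding the degenerate triplets from the total gain leaves the revenue. -/
lemma trev_inducedTriplets {n : ℕ} (H : HTree n) (hH : ∀ i, i ∈ H.leaves) :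
    Trev H (inducedTriplets H) =
      ∑ i, ∑ j, ∑ k, H.gain i j k - (∑ i, ∑ k, (H.lcaSize i k : ℤ) - (n : ℤ) ^ 2) := by
  have key : ∀ i j k : Fin n,
      (if i ≠ j ∧ i ≠ k ∧ j ≠ k ∧ H.lcaSize i j < min (H.lcaSize i k) (H.lcaSize j k) then
        (H.lcaSize i k : ℤ) - H.lcaSize i j else 0) =
      H.gain i j k - if i = j then (H.lcaSize i k : ℤ) - 1 else 0 := by
    intro i j k
    have hs := fun i => H.lcaSize_self (hH i)
    have hik := H.lcaSize_pos i k
    have hij := H.lcaSize_pos i j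
    rw [HTree.gain]
    rcases eq_or_ne i j with rfl | h₁
    · rw [if_pos rfl, hs]
      split_ifs <;> omega
    rcases eq_or_ne i k with rfl | h₂
    · simp [h₁, hs, hij.ne']
    rcases eq_or_ne j k with rfl | h₃
    · simp [h₁, hs, hij.ne']
    · simp [h₁, h₂, h₃]
  have hd : ∀ i : Fin n, ∑ j : Fin n, ∑ k : Fin n,
      (if i = j then (H.lcaSize i k : ℤ) - 1 else 0) = ∑ k, (H.lcaSize i k : ℤ) - n := by
    intro i
    rw [Finset.sum_comm]
    simp
  simp only [Trev, inducedTriplets, Finset.sum_filter, Fintype.sum_prod_type]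
  simp only [key, Finset.sum_sub_distrib, hd]
  simp [sq]

/-- `Trev(H0, T0) = 3·Σ_N |N1|·|N2|·|N|² − (2n+2)·(n³−n)/3`, the sum ranging over
the internal nodes of `H0`. -/
theorem trev_internal_nodes {n : ℕ} (H0 : HTree n) (hH0 : IsHierarchy H0) :
    (Trev H0 (inducedTriplets H0) : ℚ) =
      3 * (H0.internalSum (fun a b => a * b * (a + b) ^ 2) : ℚ)
        - (2 * (n : ℚ) + 2) * ((n : ℚ) ^ 3 - n) / 3 := by
  have hu : H0.leaves.toFinset = Finset.univ :=
    Finset.eq_univ_iff_forall.2 fun i => List.mem_toFinset.2 (hH0.2 i)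
  have hn : H0.size = n := by
    rw [← HTree.card_toFinset_leaves hH0.1, hu, Finset.card_univ, Fintype.card_fin]
  have h₁ := H0.sum_lcaSize hH0.1
  have h₂ := H0.sum_gain hH0.1
  rw [hu, hn] at h₁ h₂
  have h₃ : 3 * Trev H0 (inducedTriplets H0) =
      9 * (H0.internalSum (fun a b => a * b * (a + b) ^ 2) : ℤ)
        - (2 * (n : ℤ) + 2) * ((n : ℤ) ^ 3 - n) := by
    rw [trev_inducedTriplets H0 hH0.2]
    linear_combination h₂ - h₁
  have h₄ : 3 * (Trev H0 (inducedTriplets H0) : ℚ) =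
      9 * (H0.internalSum (fun a b => a * b * (a + b) ^ 2) : ℚ)
        - (2 * (n : ℚ) + 2) * ((n : ℚ) ^ 3 - n) := by
    exact_mod_cast h₃
  linear_combination h₄ / 3

end CompHC
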